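/- Let U ⊆ ℝ² be open and x : U → ℝ² be twice continuously differentiable with det Dx(ξ) ≠ 0 for all ξ ∈ U; let V ⊆ ℝ² be open with x(U) ⊆ V and let h : V → ℝ² be twice continuously differentiable with h(x(ξ)) = ξ for all ξ ∈ U. If both components of h are harmonic on V, i.e. Δh₁ = Δh₂ = 0 on V, then for each i ∈ {1, 2} and every ξ ∈ U one has A(ξ) : H(x_i)(ξ) = 0, where H(x_i)(ξ) is the Hessian matrix of the i-th component of x at ξ, g(ξ) = Dx(ξ)ᵀ Dx(ξ) is the metric tensor, A(ξ) = [[g₂₂, −g₁₂], [−g₁₂, g₁₁]] is its adjugate, and ':' denotes the Frobenius inner product of matrices. -/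

import Mathlib

open EuclideanSpace Matrix

/-- Partial derivative `∂f/∂ξ_j` of a scalar function on `ℝ²`. -/
noncomputable def partialD (f : EuclideanSpace ℝ (Fin 2) → ℝ) (j : Fin 2)
    (ξ : EuclideanSpace ℝ (Fin 2)) : ℝ :=
  fderiv ℝ f ξ (EuclideanSpace.single j 1)

/-- Hessian matrix `H(f)_{jk} = ∂²f/∂ξ_j∂ξ_k`. -/
noncomputable def hess (f : EuclideanSpace ℝ (Fin 2) → ℝ)
    (ξ : EuclideanSpace ℝ (Fin 2)) : Matrix (Fin 2) (Fin 2) ℝ :=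
  Matrix.of fun j k => partialD (partialD f k) j ξ

/-- Jacobian matrix `(Dx)_{ij} = ∂x_i/∂ξ_j` of a map `x : ℝ² → ℝ²`. -/
noncomputable def jacMat (x : EuclideanSpace ℝ (Fin 2) → EuclideanSpace ℝ (Fin 2))
    (ξ : EuclideanSpace ℝ (Fin 2)) : Matrix (Fin 2) (Fin 2) ℝ :=
  Matrix.of fun i j => partialD (fun η => x η i) j ξ

/-- Metric tensor `g = (Dx)ᵀ (Dx)`, i.e. `g_{jk} = (∂x/∂ξ_j) · (∂x/∂ξ_k)`. -/
noncomputable def metricTensor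
    (x : EuclideanSpace ℝ (Fin 2) → EuclideanSpace ℝ (Fin 2))
    (ξ : EuclideanSpace ℝ (Fin 2)) : Matrix (Fin 2) (Fin 2) ℝ :=
  (jacMat x ξ)ᵀ * jacMat x ξ

/-- The diffusivity matrix `A = [[g₂₂, −g₁₂], [−g₁₂, g₁₁]]`, the adjugate of
the metric tensor `g`. -/
noncomputable def diffusivity
    (x : EuclideanSpace ℝ (Fin 2) → EuclideanSpace ℝ (Fin 2))
    (ξ : EuclideanSpace ℝ (Fin 2)) : Matrix (Fin 2) (Fin 2) ℝ :=
  Matrix.of ![![metricTensor x ξ 1 1, -metricTensor x ξ 0 1],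
              ![-metricTensor x ξ 0 1, metricTensor x ξ 0 0]]

lemma aux_chain (f : EuclideanSpace ℝ (Fin 2) → ℝ)
    (x : EuclideanSpace ℝ (Fin 2) → EuclideanSpace ℝ (Fin 2))
    (ξ : EuclideanSpace ℝ (Fin 2)) (hf : DifferentiableAt ℝ f (x ξ))
    (hx : DifferentiableAt ℝ x ξ) (j : Fin 2) :
    partialD (fun η => f (x η)) j ξ =
      ∑ a : Fin 2, partialD f a (x ξ) * partialD (fun η => x η a) j ξ := by
  have hc : ∀ a : Fin 2, partialD (fun η => x η a) j ξ
      = (fderiv ℝ x ξ (EuclideanSpace.single j 1)) a := by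
    intro a
    have h1 := ((EuclideanSpace.proj a : EuclideanSpace ℝ (Fin 2) →L[ℝ] ℝ).hasFDerivAt
      (x := x ξ)).comp ξ hx.hasFDerivAt
    have h2 : fderiv ℝ (fun η => x η a) ξ = _ := h1.fderiv
    rw [partialD, h2]
    rfl
  have h1 := hf.hasFDerivAt.comp ξ hx.hasFDerivAt
  have h2 : fderiv ℝ (fun η => f (x η)) ξ = _ := h1.fderiv
  rw [partialD, h2]
  simp only [hc]
  set v := fderiv ℝ x ξ (EuclideanSpace.single j 1) with hv
  have hv2 : v = v 0 • EuclideanSpace.single 0 1 + v 1 • EuclideanSpace.single 1 1 := by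
    ext i
    fin_cases i <;> simp
  have h3 : fderiv ℝ f (x ξ) v = v 0 * partialD f 0 (x ξ) + v 1 * partialD f 1 (x ξ) := by
    conv_lhs => rw [hv2]
    simp [partialD]
  rw [ContinuousLinearMap.comp_apply, ← hv, h3, Fin.sum_univ_two]
  ring

lemma aux_diff (f : EuclideanSpace ℝ (Fin 2) → ℝ) (p : EuclideanSpace ℝ (Fin 2))
    (hf : ContDiffAt ℝ 2 f p) (j : Fin 2) : DifferentiableAt ℝ (partialD f j) p := by
  have h1 : ContDiffAt ℝ 1 (fderiv ℝ f) p := hf.fderiv_right (by norm_num)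
  have h2 : DifferentiableAt ℝ (fderiv ℝ f) p := h1.differentiableAt (by norm_num)
  exact h2.clm_apply (differentiableAt_const _)

lemma aux_comp (f : EuclideanSpace ℝ (Fin 2) → EuclideanSpace ℝ (Fin 2))
    (p : EuclideanSpace ℝ (Fin 2)) (hf : ContDiffAt ℝ 2 f p) (i : Fin 2) :
    ContDiffAt ℝ 2 (fun q => f q i) p :=
  (EuclideanSpace.proj i : EuclideanSpace ℝ (Fin 2) →L[ℝ] ℝ).contDiff.contDiffAt.comp p hf

lemma aux_coord (m j : Fin 2) (ξ : EuclideanSpace ℝ (Fin 2)) :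
    partialD (fun η => η m) j ξ = if m = j then 1 else 0 := by
  have h2 : fderiv ℝ (fun η : EuclideanSpace ℝ (Fin 2) => η m) ξ = _ :=
    ((EuclideanSpace.proj m : EuclideanSpace ℝ (Fin 2) →L[ℝ] ℝ).hasFDerivAt (x := ξ)).fderiv
  rw [partialD, h2]
  simp [Pi.single_apply]

/-- If `x : U → ℝ²` is a `C²` diffeomorphic parameterisation whose inverse
`h` has harmonic components on `V ⊇ x(U)`, then each component `x_i`
satisfies the nondivergence-form equation `A(x) : H(x_i) = 0` on `U`, where
`A` is the adjugate of the metric tensor and `:` is the Frobenius inner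
product. -/
theorem inverse_harmonic_implies_nondivergence
    (U V : Set (EuclideanSpace ℝ (Fin 2))) (hU : IsOpen U) (hV : IsOpen V)
    (x h : EuclideanSpace ℝ (Fin 2) → EuclideanSpace ℝ (Fin 2))
    (hx : ContDiffOn ℝ 2 x U) (hh : ContDiffOn ℝ 2 h V)
    (hmaps : Set.MapsTo x U V)
    (hdet : ∀ ξ ∈ U, (jacMat x ξ).det ≠ 0)
    (hinv : ∀ ξ ∈ U, h (x ξ) = ξ)
    (hharm : ∀ i : Fin 2, ∀ p ∈ V,
      ∑ j : Fin 2, partialD (partialD (fun q => h q i) j) j p = 0) :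
    ∀ i : Fin 2, ∀ ξ ∈ U,
      ∑ j : Fin 2, ∑ k : Fin 2,
        diffusivity x ξ j k * hess (fun η => x η i) ξ j k = 0 := by
  have hxa : ∀ ξ ∈ U, ContDiffAt ℝ 2 x ξ := fun ξ hξ => hx.contDiffAt (hU.mem_nhds hξ)
  have hha : ∀ p ∈ V, ContDiffAt ℝ 2 h p := fun p hp => hh.contDiffAt (hV.mem_nhds hp)
  have hxd : ∀ ξ ∈ U, DifferentiableAt ℝ x ξ :=
    fun ξ hξ => (hxa ξ hξ).differentiableAt (by norm_num)
  -- first order identity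
  have first : ∀ m j : Fin 2, ∀ ξ ∈ U,
      ∑ a : Fin 2, partialD (fun q => h q m) a (x ξ) * partialD (fun η => x η a) j ξ
        = if m = j then 1 else 0 := by
    intro m j ξ hξ
    rw [← aux_chain (fun q => h q m) x ξ
      ((aux_comp h _ (hha _ (hmaps hξ)) m).differentiableAt (by norm_num)) (hxd ξ hξ) j,
      ← aux_coord m j ξ]
    have : (fun η => h (x η) m) =ᶠ[nhds ξ] fun η => η m := by
      filter_upwards [hU.mem_nhds hξ] with η hη
      rw [hinv η hη]
    rw [partialD, partialD, this.fderiv_eq]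
  -- second order identity
  have second : ∀ m j k : Fin 2, ∀ ξ ∈ U,
      ∑ a : Fin 2, ((∑ b : Fin 2, partialD (partialD (fun q => h q m) a) b (x ξ)
          * partialD (fun η => x η b) k ξ) * partialD (fun η => x η a) j ξ
        + partialD (fun q => h q m) a (x ξ) * partialD (partialD (fun η => x η a) j) k ξ)
        = 0 := by
    intro m j k ξ hξ
    have hev : (fun η => ∑ a : Fin 2, partialD (fun q => h q m) a (x η) *
        partialD (fun η => x η a) j η) =ᶠ[nhds ξ] fun _ => (if m = j then (1:ℝ) else 0) := by
      filter_upwards [hU.mem_nhds hξ] with η hη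
      exact first m j η hη
    have hz : partialD (fun η => ∑ a : Fin 2, partialD (fun q => h q m) a (x η) *
        partialD (fun η => x η a) j η) k ξ = 0 := by
      rw [partialD, hev.fderiv_eq]
      simp
    rw [← hz]
    have hd1 : ∀ a, DifferentiableAt ℝ (partialD (fun q => h q m) a) (x ξ) :=
      fun a => aux_diff _ _ (aux_comp h _ (hha _ (hmaps hξ)) m) a
    have hd2 : ∀ a, DifferentiableAt ℝ (fun η => partialD (fun q => h q m) a (x η)) ξ :=
      fun a => (hd1 a).comp ξ (hxd ξ hξ)
    have hd3 : ∀ a, DifferentiableAt ℝ (partialD (fun η => x η a) j) ξ :=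
      fun a => aux_diff _ _ (aux_comp x _ (hxa _ hξ) a) j
    have hs := (HasFDerivAt.fun_sum (u := Finset.univ) (fun a _ =>
      (hd2 a).hasFDerivAt.mul (hd3 a).hasFDerivAt)).fderiv
    conv_rhs => rw [partialD]
    erw [hs]
    rw [ContinuousLinearMap.sum_apply]
    refine Finset.sum_congr rfl fun a _ => ?_
    rw [← aux_chain _ x ξ (hd1 a) (hxd ξ hξ) k]
    simp only [partialD, ContinuousLinearMap.add_apply, ContinuousLinearMap.smul_apply,
      smul_eq_mul]
    ring
  intro i ξ hξ
  have f00 := first 0 0 ξ hξ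
  have f01 := first 0 1 ξ hξ
  have f10 := first 1 0 ξ hξ
  have f11 := first 1 1 ξ hξ
  have L0 := hharm 0 _ (hmaps hξ)
  have L1 := hharm 1 _ (hmaps hξ)
  have s0 := fun j k => second 0 j k ξ hξ
  have s1 := fun j k => second 1 j k ξ hξ
  have s000 := s0 0 0
  have s001 := s0 0 1
  have s010 := s0 1 0
  have s011 := s0 1 1
  have s100 := s1 0 0
  have s101 := s1 0 1
  have s110 := s1 1 0
  have s111 := s1 1 1
  clear s0 s1 first second
  simp only [diffusivity, metricTensor, hess, jacMat, Matrix.mul_apply, Matrix.transpose_apply,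
    Matrix.of_apply, Fin.sum_univ_two, Matrix.cons_val_zero, Matrix.cons_val_one] at *
  simp only [if_true, zero_ne_one, one_ne_zero, if_false] at f00 f01 f10 f11
  generalize partialD (fun η => x η 0) 0 ξ = J00 at *
  generalize partialD (fun η => x η 0) 1 ξ = J01 at *
  generalize partialD (fun η => x η 1) 0 ξ = J10 at *
  generalize partialD (fun η => x η 1) 1 ξ = J11 at *
  generalize partialD (fun q => h q 0) 0 (x ξ) = B00 at *
  generalize partialD (fun q => h q 0) 1 (x ξ) = B01 at *
  generalize partialD (fun q => h q 1) 0 (x ξ) = B10 at *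
  generalize partialD (fun q => h q 1) 1 (x ξ) = B11 at *
  generalize hg0 : J01 * J01 + J11 * J11 = g11
  generalize hg1 : J00 * J01 + J10 * J11 = g01
  generalize hg2 : J00 * J00 + J10 * J10 = g00
  have hBJ : !![B00, B01; B10, B11] * !![J00, J01; J10, J11] = 1 := by
    rw [Matrix.mul_fin_two, f00, f01, f10, f11, Matrix.one_fin_two]
  have hJB := mul_eq_one_comm.mp hBJ
  rw [Matrix.mul_fin_two, Matrix.one_fin_two] at hJB
  have e00 := congrFun (congrFun hJB 0) 0
  have e01 := congrFun (congrFun hJB 0) 1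
  have e10 := congrFun (congrFun hJB 1) 0
  have e11 := congrFun (congrFun hJB 1) 1
  simp only [Matrix.of_apply, Matrix.cons_val_zero, Matrix.cons_val_one, Matrix.cons_val',
    Matrix.cons_val_fin_one] at e00 e01 e10 e11
  have key : ∀ T0 T1 : ℝ, B00 * T0 + B01 * T1 = 0 → B10 * T0 + B11 * T1 = 0 →
      T0 = 0 ∧ T1 = 0 := by
    intro T0 T1 h0 h1
    constructor
    · linear_combination J00 * h0 + J01 * h1 - T0 * e00 - T1 * e01
    · linear_combination J10 * h0 + J11 * h1 - T0 * e10 - T1 * e11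
  have main := key
    (g11 * partialD (partialD (fun η => x η 0) 0) 0 ξ +
      -g01 * partialD (partialD (fun η => x η 0) 1) 0 ξ +
      (-g01 * partialD (partialD (fun η => x η 0) 0) 1 ξ +
      g00 * partialD (partialD (fun η => x η 0) 1) 1 ξ))
    (g11 * partialD (partialD (fun η => x η 1) 0) 0 ξ +
      -g01 * partialD (partialD (fun η => x η 1) 1) 0 ξ +
      (-g01 * partialD (partialD (fun η => x η 1) 0) 1 ξ +
      g00 * partialD (partialD (fun η => x η 1) 1) 1 ξ))
    (by
      subst hg0 hg1 hg2
      linear_combination (J01 * J01 + J11 * J11) * s000 - (J00 * J01 + J10 * J11) * s001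
        - (J00 * J01 + J10 * J11) * s010 + (J00 * J00 + J10 * J10) * s011
        - (J00 * J11 - J01 * J10) ^ 2 * L0)
    (by
      subst hg0 hg1 hg2
      linear_combination (J01 * J01 + J11 * J11) * s100 - (J00 * J01 + J10 * J11) * s101
        - (J00 * J01 + J10 * J11) * s110 + (J00 * J00 + J10 * J10) * s111
        - (J00 * J11 - J01 * J10) ^ 2 * L1)
  fin_cases i
  · exact main.1
  · exact main.2
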